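/- (Discrete comparison lemma for an impeded process.) Let Q(0), Q'(0) : ℕ → ℕ be finitely supported with Q(0) ⪯ Q'(0). Let M ∈ ℕ and let e_1, …, e_M be a sequence of events, each being either (a) a transfer event labeled by some n_i ∈ ℕ, or (b) an arrival event labeled by a pair of indicators (ε_i, ε'_i) ∈ {0,1}². Define configurations recursively: at a transfer event, Q(i) is the BP transfer at (n_i, n_i+1) applied to Q(i−1) and Q'(i) is the BP transfer at (n_i, n_i+1) applied to Q'(i−1); at an arrival event, Q(i) = Q(i−1) + ε_i·δ_0 and Q'(i) = Q'(i−1) + ε'_i·δ_0, where δ_0 is the function equal to 1 at site 0 and 0 elsewhere. Assume the arrivals to the first system are delayed: for every i ≤ M, the sum of ε_j over arrival events e_j with j ≤ i is at most the corresponding sum of ε'_j. Then Q(i) ⪯ Q'(i) for every i ≤ M. -/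

import Mathlib

/-- The back-pressure (BP) transfer at the pair `(n, n+1)`. -/
def bpTransfer (n : ℕ) (Q : ℕ → ℕ) : ℕ → ℕ :=
  if Q (n + 1) < Q n then
    fun k => if k = n then Q n - 1 else if k = n + 1 then Q (n + 1) + 1 else Q k
  else Q

/-- Finitely supported configuration. -/
def FinSupp (Q : ℕ → ℕ) : Prop := ∃ N, ∀ k, N ≤ k → Q k = 0

/-- The tail-sum partial order: `Q ⪯ Q'` iff `∑_{k ≥ n} Q k ≤ ∑_{k ≥ n} Q' k` for all `n`. -/
def TailLE (Q Q' : ℕ → ℕ) : Prop :=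
  ∀ n : ℕ, (∑' k : ℕ, Q (n + k)) ≤ ∑' k : ℕ, Q' (n + k)

/-- An event is either a transfer event labeled by `n` (`Sum.inl n`), or an arrival
event labeled by a pair of indicators `(ε, ε')` (`Sum.inr (ε, ε')`). -/
abbrev BPEvent := ℕ ⊕ (Bool × Bool)

/-- The number of particles at sites `≥ n`. -/
noncomputable def tailSum (Q : ℕ → ℕ) (n : ℕ) : ℕ := ∑' k : ℕ, Q (n + k)

theorem FinSupp.tailSum_eq_add {Q : ℕ → ℕ} (hQ : FinSupp Q) (n : ℕ) :
    tailSum Q n = Q n + tailSum Q (n + 1) := by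
  obtain ⟨N, hN⟩ := hQ
  have hs : Summable fun k => Q (n + (k + 1)) :=
    summable_of_ne_finset_zero (s := Finset.range N) fun k hk =>
      hN _ (by simp only [Finset.mem_range] at hk; omega)
  simp only [tailSum, tsum_eq_zero_add' (f := fun k => Q (n + k)) hs, Nat.add_zero,
    Nat.add_assoc, Nat.add_comm 1]

theorem tailSum_eq_zero {Q : ℕ → ℕ} {N n : ℕ} (hN : ∀ k, N ≤ k → Q k = 0) (hn : N ≤ n) :
    tailSum Q n = 0 := by
  have h : ∀ k, Q (n + k) = 0 := fun k => hN _ (by omega)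
  simp [tailSum, h]

/-- An eventually zero function satisfying the recursion of the tail sums of `Q` is `tailSum Q`. -/
theorem FinSupp.tailSum_eq_of_recursion {Q f : ℕ → ℕ} (hQ : FinSupp Q) (hf : FinSupp f)
    (hrec : ∀ n, f n = Q n + f (n + 1)) (n : ℕ) : tailSum Q n = f n := by
  obtain ⟨N, hN⟩ := id hQ
  obtain ⟨K, hK⟩ := hf
  have key : ∀ d n, N + K ≤ n + d → tailSum Q n = f n := by
    intro d
    induction d with
    | zero =>
      intro n hn
      rw [tailSum_eq_zero hN (by omega), hK n (by omega)]
    | succ d ih =>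
      intro n hn
      rw [hQ.tailSum_eq_add, hrec, ih (n + 1) (by omega)]
  exact key (N + K) n (by omega)

theorem FinSupp.finSupp_tailSum {Q : ℕ → ℕ} (hQ : FinSupp Q) : FinSupp (tailSum Q) := by
  obtain ⟨N, hN⟩ := hQ
  exact ⟨N, fun _ hn => tailSum_eq_zero hN hn⟩

theorem FinSupp.add_ite {Q : ℕ → ℕ} (hQ : FinSupp Q) (p : Prop) [Decidable p] (m : ℕ) :
    FinSupp fun k => Q k + (if p ∧ k = m then 1 else 0) := by
  obtain ⟨N, hN⟩ := hQ
  refine ⟨N + m + 1, fun k hk => ?_⟩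
  have hkm : k ≠ m := by omega
  simp [hN k (by omega), hkm]

theorem FinSupp.finSupp_bpTransfer {Q : ℕ → ℕ} (hQ : FinSupp Q) (n : ℕ) :
    FinSupp (bpTransfer n Q) := by
  obtain ⟨N, hN⟩ := hQ
  refine ⟨N + n + 2, fun k hk => ?_⟩
  have := hN k (by omega)
  unfold bpTransfer
  split_ifs <;> grind

/-- An arrival at site `0` changes only the total number of particles. -/
theorem FinSupp.tailSum_arrival {Q : ℕ → ℕ} (hQ : FinSupp Q) (p : Prop) [Decidable p] (k : ℕ) :
    tailSum (fun k => Q k + (if p ∧ k = 0 then 1 else 0)) k =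
      tailSum Q k + (if p ∧ k = 0 then 1 else 0) := by
  refine (hQ.add_ite p 0).tailSum_eq_of_recursion (hQ.finSupp_tailSum.add_ite p 0) (fun k => ?_) k
  have := hQ.tailSum_eq_add k
  grind

/-- A transfer at `(n, n + 1)` changes only the tail sum at `n + 1`. -/
theorem FinSupp.tailSum_bpTransfer {Q : ℕ → ℕ} (hQ : FinSupp Q) (n k : ℕ) :
    tailSum (bpTransfer n Q) k =
      tailSum Q k + (if Q (n + 1) < Q n ∧ k = n + 1 then 1 else 0) := by
  refine (hQ.finSupp_bpTransfer n).tailSum_eq_of_recursion (hQ.finSupp_tailSum.add_ite _ _) (fun k => ?_) k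
  have := hQ.tailSum_eq_add k
  unfold bpTransfer
  split_ifs <;> grind

/-- The BP transfer is monotone for the tail-sum order. -/
theorem tailSum_bpTransfer_le {Q Q' : ℕ → ℕ} (hQ : FinSupp Q) (hQ' : FinSupp Q')
    (h : ∀ k, tailSum Q k ≤ tailSum Q' k) (n k : ℕ) :
    tailSum (bpTransfer n Q) k ≤ tailSum (bpTransfer n Q') k := by
  rw [hQ.tailSum_bpTransfer, hQ'.tailSum_bpTransfer]
  have h₀ := h n
  have h₁ := h (n + 1)
  have h₂ := h (n + 1 + 1)
  have hk := h k
  have hn := hQ.tailSum_eq_add n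
  have hn₁ := hQ.tailSum_eq_add (n + 1)
  have hn' := hQ'.tailSum_eq_add n
  have hn₁' := hQ'.tailSum_eq_add (n + 1)
  by_cases hkn : k = n + 1
  · subst hkn
    simp only [and_true]
    split_ifs <;> omega
  · simp [hkn, hk]

/-- In a system driven by transfers and by arrivals at site `0`, configurations stay finitely
supported and the total number of particles grows by the number of arrivals. -/
theorem finSupp_and_tailSum_zero_of_step {M : ℕ} {e : ℕ → BPEvent} {Q : ℕ → ℕ → ℕ}
    (π : Bool × Bool → Bool) (h0 : FinSupp (Q 0))
    (hstep : ∀ i < M, Q (i + 1) =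
      Sum.elim (fun n => bpTransfer n (Q i))
        (fun p => fun k => Q i k + (if π p = true ∧ k = 0 then 1 else 0)) (e i)) :
    ∀ i ≤ M, FinSupp (Q i) ∧ tailSum (Q i) 0 = tailSum (Q 0) 0 +
      ∑ j ∈ Finset.range i,
        Sum.elim (fun _ => 0) (fun p => if π p = true then 1 else 0) (e j) := by
  intro i
  induction i with
  | zero => exact fun _ => ⟨h0, by simp⟩
  | succ i ih =>
    intro hi
    obtain ⟨hfin, htot⟩ := ih (by omega)
    rw [hstep i (by omega), Finset.sum_range_succ, ← Nat.add_assoc, ← htot]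
    rcases e i with n | p
    · exact ⟨hfin.finSupp_bpTransfer n, by simp [hfin.tailSum_bpTransfer]⟩
    · exact ⟨hfin.add_ite _ 0, by simp [hfin.tailSum_arrival]⟩

/-- Discrete comparison lemma for an impeded process: if the arrivals to the first
system are delayed with respect to the second, and both systems experience the same
transfer bells, then the first system stays behind in the tail-sum order. -/
theorem impeded_comparison (Q0 Q0' : ℕ → ℕ) (hQ0 : FinSupp Q0) (hQ0' : FinSupp Q0')
    (h0 : TailLE Q0 Q0') (M : ℕ) (e : ℕ → BPEvent) (Q Q' : ℕ → ℕ → ℕ)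
    (hinit : Q 0 = Q0) (hinit' : Q' 0 = Q0')
    (hstep : ∀ i < M, Q (i + 1) =
      Sum.elim (fun n => bpTransfer n (Q i))
        (fun p => fun k => Q i k + (if p.1 = true ∧ k = 0 then 1 else 0)) (e i))
    (hstep' : ∀ i < M, Q' (i + 1) =
      Sum.elim (fun n => bpTransfer n (Q' i))
        (fun p => fun k => Q' i k + (if p.2 = true ∧ k = 0 then 1 else 0)) (e i))
    (hdelay : ∀ i ≤ M,
      (∑ j ∈ Finset.range i,
          Sum.elim (fun _ => 0) (fun p => if p.1 = true then 1 else 0) (e j)) ≤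
        ∑ j ∈ Finset.range i,
          Sum.elim (fun _ => 0) (fun p => if p.2 = true then 1 else 0) (e j)) :
    ∀ i ≤ M, TailLE (Q i) (Q' i) := by
  subst hinit hinit'
  have hQ := finSupp_and_tailSum_zero_of_step Prod.fst hQ0 hstep
  have hQ' := finSupp_and_tailSum_zero_of_step Prod.snd hQ0' hstep'
  suffices h : ∀ i ≤ M, ∀ k, tailSum (Q i) k ≤ tailSum (Q' i) k from h
  intro i
  induction i with
  | zero => exact fun _ => h0
  | succ i ih =>
    intro hi k
    have hle := ih (by omega)
    have hfin := (hQ i (by omega)).1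
    have hfin' := (hQ' i (by omega)).1
    rcases Nat.eq_zero_or_pos k with rfl | hk
    · rw [(hQ _ hi).2, (hQ' _ hi).2]
      exact Nat.add_le_add (h0 0) (hdelay _ hi)
    · rw [hstep i (by omega), hstep' i (by omega)]
      rcases e i with n | p
      · exact tailSum_bpTransfer_le hfin hfin' hle n k
      · simpa [hfin.tailSum_arrival, hfin'.tailSum_arrival, hk.ne'] using hle k
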